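/- Let G be a finite simple graph, let r be a positive integer, and let H be a proper subgraph of G with V(H) ≠ V(G). If the induced subgraph G − V(H) is not r-correspondence-deletable in G, then there exist a subgraph G₀ of G containing H and an r-correspondence assignment (L,M) for G such that G₀ is H-critical with respect to (L,M). -/

import Mathlib

open SimpleGraph

/-- A correspondence assignment `(L, M)` for a graph `G` with colours in `C`:
a list assignment `L` giving each vertex a finite set of colours, together with,
for each edge `uv`, a partial matching `M u v` between `{u} × L u` and `{v} × L v`. -/
structure CorrAssignment {V : Type} (G : SimpleGraph V) (C : Type) : Type where
  L : V → Finset C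
  M : V → V → C → C → Prop
  adj_of_M : ∀ u v a b, M u v a b → G.Adj u v
  mem_left : ∀ u v a b, M u v a b → a ∈ L u
  mem_right : ∀ u v a b, M u v a b → b ∈ L v
  symm : ∀ u v a b, M u v a b → M v u b a
  match_right : ∀ u v a b b', M u v a b → M u v a b' → b = b'
  match_left : ∀ u v a a' b, M u v a b → M u v a' b → a = a'

/-- A `k`-correspondence assignment: every list has at least `k` colours. -/
def CorrAssignment.IsKAssignment {V C : Type} {G : SimpleGraph V}
    (LM : CorrAssignment G C) (k : ℕ) : Prop :=
  ∀ v, k ≤ (LM.L v).card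

/-- An `(L, M)`-colouring of `G`. -/
def CorrAssignment.IsColouring {V C : Type} {G : SimpleGraph V}
    (LM : CorrAssignment G C) (φ : V → C) : Prop :=
  (∀ v, φ v ∈ LM.L v) ∧ ∀ u v, G.Adj u v → ¬ LM.M u v (φ u) (φ v)

/-- An `(L, M)`-colouring of a subgraph `H` of `G` (with respect to the restriction of
`(L, M)` to `H`), recorded as a total function whose conditions concern only `H`. -/
def CorrAssignment.ColouringOn {V C : Type} {G : SimpleGraph V}
    (LM : CorrAssignment G C) (H : G.Subgraph) (φ : V → C) : Prop :=
  (∀ v ∈ H.verts, φ v ∈ LM.L v) ∧ ∀ u v, H.Adj u v → ¬ LM.M u v (φ u) (φ v)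

/-- The degree of `v` in `G`. -/
noncomputable def degree' {V : Type} (G : SimpleGraph V) (v : V) : ℕ :=
  Nat.card (G.neighborSet v)

/-- The (nonempty) induced subgraph of `G` on the vertex set `X` is
`r`-correspondence-deletable in `G`. -/
def Deletable {V : Type} (G : SimpleGraph V) (X : Set V) (r : ℕ) : Prop :=
  X.Nonempty ∧
  ∀ (C : Type) (LM : CorrAssignment (G.induce X) C),
    (∀ v : X, r - (degree' G ↑v - degree' (G.induce X) v) ≤ (LM.L v).card) →
    ∃ φ : X → C, LM.IsColouring φ

/-- `G₀` (a subgraph of `G`) is `S`-critical with respect to the correspondence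
assignment `(L, M)` for `G`: `S` is a proper subgraph of `G₀`, and for every proper
subgraph `G'` of `G₀` containing `S` there is an `(L, M)`-colouring of `S` that extends
to an `(L, M)`-colouring of `G'` but does not extend to an `(L, M)`-colouring of `G₀`. -/
def IsCriticalWrt {V C : Type} {G : SimpleGraph V} (LM : CorrAssignment G C)
    (G₀ S : G.Subgraph) : Prop :=
  S ≤ G₀ ∧ S ≠ G₀ ∧
  ∀ G' : G.Subgraph, S ≤ G' → G' ≤ G₀ → G' ≠ G₀ →
    ∃ φ : V → C, LM.ColouringOn S φ ∧
      (∃ φ' : V → C, LM.ColouringOn G' φ' ∧ ∀ v ∈ S.verts, φ' v = φ v) ∧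
      ¬ ∃ φ'' : V → C, LM.ColouringOn G₀ φ'' ∧ ∀ v ∈ S.verts, φ'' v = φ v

/-- Matching of the extended assignment. -/
inductive ExtM {V C : Type} {G : SimpleGraph V} (X : Set V) (r : ℕ) (hr : 0 < r)
    (LM : CorrAssignment (G.induce X) C) : V → V → C ⊕ V ⊕ Fin r → C ⊕ V ⊕ Fin r → Prop
  | inner (u v : X) (a b : C) (h : LM.M u v a b) : ExtM X r hr LM u v (.inl a) (.inl b)
  | out (u v : V) (hu : u ∉ X) (hv : v ∈ X) (h : G.Adj u v) :
      ExtM X r hr LM u v (.inr (.inr ⟨0, hr⟩)) (.inr (.inl u))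
  | into (u v : V) (hu : u ∉ X) (hv : v ∈ X) (h : G.Adj u v) :
      ExtM X r hr LM v u (.inr (.inl u)) (.inr (.inr ⟨0, hr⟩))

/-- Lists of the extended assignment. -/
def extS {V C : Type} {G : SimpleGraph V} (X : Set V) (r : ℕ)
    (LM : CorrAssignment (G.induce X) C) (v : V) : Set (C ⊕ V ⊕ Fin r) :=
  {c | match c with
    | .inl a => ∃ h : v ∈ X, a ∈ LM.L ⟨v, h⟩
    | .inr (.inl u) => v ∈ X ∧ u ∉ X ∧ G.Adj u v
    | .inr (.inr _) => v ∉ X}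

theorem extS_finite {V C : Type} [Fintype V] {G : SimpleGraph V} (X : Set V) (r : ℕ)
    (LM : CorrAssignment (G.induce X) C) (v : V) : (extS X r LM v).Finite := by
  classical
  have h2 : (Set.range (Sum.inr : V ⊕ Fin r → C ⊕ V ⊕ Fin r)).Finite := Set.finite_range _
  by_cases hv : v ∈ X
  · refine (((LM.L ⟨v, hv⟩).finite_toSet.image Sum.inl).union h2).subset ?_
    rintro (a | a) h
    · obtain ⟨_, h⟩ := h
      exact Or.inl ⟨a, h, rfl⟩
    · exact Or.inr ⟨a, rfl⟩
  · refine h2.subset ?_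
    rintro (a | a) h
    · obtain ⟨h', h⟩ := h
      exact absurd h' hv
    · exact ⟨a, rfl⟩

/-- The extended assignment. -/
noncomputable def extLM {V C : Type} [Fintype V] {G : SimpleGraph V} (X : Set V) (r : ℕ)
    (hr : 0 < r) (LM : CorrAssignment (G.induce X) C) : CorrAssignment G (C ⊕ V ⊕ Fin r) where
  L v := (extS_finite X r LM v).toFinset
  M := ExtM X r hr LM
  adj_of_M := by
    rintro u v a b (⟨u, v, a, b, h⟩ | ⟨u, v, hu, hv, h⟩ | ⟨u, v, hu, hv, h⟩)
    · exact LM.adj_of_M _ _ _ _ h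
    · exact h
    · exact h.symm
  mem_left := by
    rintro u v a b (⟨u, v, a, b, h⟩ | ⟨u, v, hu, hv, h⟩ | ⟨u, v, hu, hv, h⟩)
    · simpa [extS] using LM.mem_left _ _ _ _ h
    · simpa [extS] using hu
    · simpa [extS] using ⟨hv, hu, h⟩
  mem_right := by
    rintro u v a b (⟨u, v, a, b, h⟩ | ⟨u, v, hu, hv, h⟩ | ⟨u, v, hu, hv, h⟩)
    · simpa [extS] using LM.mem_right _ _ _ _ h
    · simpa [extS] using ⟨hv, hu, h⟩
    · simpa [extS] using hu
  symm := by
    rintro u v a b (⟨u, v, a, b, h⟩ | ⟨u, v, hu, hv, h⟩ | ⟨u, v, hu, hv, h⟩)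
    · exact .inner _ _ _ _ (LM.symm _ _ _ _ h)
    · exact .into _ _ hu hv h
    · exact .out _ _ hu hv h
  match_right := by
    rintro u v a b b' h1 h2
    cases h1 with
    | inner u v a b h =>
      generalize hu : (u : V) = u' at h2
      generalize hv : (v : V) = v' at h2
      cases h2 with
      | inner u2 v2 a2 b2 h2 =>
        obtain rfl := Subtype.ext hu
        obtain rfl := Subtype.ext hv
        rw [LM.match_right _ _ _ _ _ h h2]
    | out _ _ hu hv h => cases h2; rfl
    | into _ _ hu hv h => cases h2; rfl
  match_left := by
    rintro u v a a' b h1 h2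
    cases h1 with
    | inner u v a b h =>
      generalize hu : (u : V) = u' at h2
      generalize hv : (v : V) = v' at h2
      cases h2 with
      | inner u2 v2 a2 b2 h2 =>
        obtain rfl := Subtype.ext hu
        obtain rfl := Subtype.ext hv
        rw [LM.match_left _ _ _ _ _ h h2]
    | out _ _ hu hv h => cases h2; rfl
    | into _ _ hu hv h => cases h2; rfl

theorem degree_split {V : Type} [Fintype V] (G : SimpleGraph V) (X : Set V) (v : X) :
    degree' G v = degree' (G.induce X) v + {u | u ∉ X ∧ G.Adj u v}.ncard := by
  have h1 : degree' (G.induce X) v = {u | u ∈ X ∧ G.Adj u v}.ncard := by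
    unfold degree'
    rw [Nat.card_coe_set_eq, ← Set.ncard_image_of_injective _ Subtype.val_injective]
    congr 1
    ext u
    simp [G.adj_comm, and_comm]
  rw [h1, ← Set.ncard_union_eq]
  · unfold degree'
    rw [Nat.card_coe_set_eq]
    congr 1
    ext u
    simp [G.adj_comm]
    tauto
  · rw [Set.disjoint_left]
    rintro u ⟨h, _⟩ ⟨h', _⟩
    exact h' h

theorem extLM_isK {V C : Type} [Fintype V] {G : SimpleGraph V} (X : Set V) (r : ℕ)
    (hr : 0 < r) (LM : CorrAssignment (G.induce X) C)
    (hL : ∀ v : X, r - (degree' G ↑v - degree' (G.induce X) v) ≤ (LM.L v).card) :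
    (extLM X r hr LM).IsKAssignment r := by
  intro v
  change r ≤ (extS_finite X r LM v).toFinset.card
  rw [← Set.ncard_eq_toFinset_card _ (extS_finite X r LM v)]
  by_cases hv : v ∈ X
  · have h := hL ⟨v, hv⟩
    have h2 := degree_split G X ⟨v, hv⟩
    have h3 : extS X r LM v = (Sum.inl '' (LM.L ⟨v, hv⟩ : Set C)) ∪
        ((Sum.inr ∘ Sum.inl) '' {u | u ∉ X ∧ G.Adj u v}) := by
      ext (c | c | c) <;> simp [extS, hv]
    rw [h3, Set.ncard_union_eq _ ((Finset.finite_toSet _).image _) (Set.toFinite _),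
      Set.ncard_image_of_injective _ Sum.inl_injective,
      Set.ncard_image_of_injective _ (Sum.inr_injective.comp Sum.inl_injective),
      Set.ncard_coe_finset]
    · dsimp only at h h2
      omega
    · rw [Set.disjoint_left]
      rintro _ ⟨a, _, rfl⟩ ⟨b, _, h⟩
      cases h
  · have h3 : extS X r LM v = Set.range (Sum.inr ∘ Sum.inr) := by
      ext (c | c | c) <;> simp [extS, hv]
    rw [h3, ← Set.image_univ,
      Set.ncard_image_of_injective _ (Sum.inr_injective.comp Sum.inr_injective)]
    simp

/-- If `H` is a proper subgraph of `G` with `V(H) ≠ V(G)` and the induced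
subgraph `G − V(H)` is not `r`-correspondence-deletable in `G`, then there exist a subgraph
`G₀` of `G` containing `H` and an `r`-correspondence assignment `(L, M)` for `G` such that
`G₀` is `H`-critical with respect to `(L, M)`. -/
theorem notDeletable_implies_critical {V : Type} [Fintype V] (G : SimpleGraph V)
    (r : ℕ) (hr : 0 < r) (H : G.Subgraph) (hH : H ≠ ⊤) (hV : H.verts ≠ Set.univ)
    (hnd : ¬ Deletable G H.vertsᶜ r) :
    ∃ (G₀ : G.Subgraph) (C : Type) (LM : CorrAssignment G C),
      H ≤ G₀ ∧ LM.IsKAssignment r ∧ IsCriticalWrt LM G₀ H := by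
  classical
  have hne : (H.vertsᶜ).Nonempty := Set.nonempty_compl.mpr hV
  have hnd' : ∃ (C : Type) (LM : CorrAssignment (G.induce H.vertsᶜ) C),
    (∀ v : (H.vertsᶜ : Set V), r - (degree' G ↑v - degree' (G.induce H.vertsᶜ) v) ≤
      (LM.L v).card) ∧ ¬ ∃ φ : (H.vertsᶜ : Set V) → C, LM.IsColouring φ := by
    by_contra hcon
    refine hnd ⟨hne, fun C LM h => ?_⟩
    by_contra h'
    exact hcon ⟨C, LM, h, h'⟩
  obtain ⟨C, LM, hL, hno⟩ := hnd'
  let E := extLM H.vertsᶜ r hr LM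
  let φ₀ : V → C ⊕ V ⊕ Fin r := fun _ => .inr (.inr ⟨0, hr⟩)
  have hφ₀ : E.ColouringOn H φ₀ := by
    refine ⟨fun v hv => ?_, fun u v _ h => ?_⟩
    · simpa [E, extLM, φ₀, extS] using hv
    · change ExtM _ _ _ _ _ _ (Sum.inr (Sum.inr _)) (Sum.inr (Sum.inr _)) at h
      cases h
  let P : G.Subgraph → Prop := fun K => H ≤ K ∧
    ¬ ∃ φ : V → C ⊕ V ⊕ Fin r, E.ColouringOn K φ ∧ ∀ v ∈ H.verts, φ v = φ₀ v
  have htop : P ⊤ := by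
    refine ⟨le_top, ?_⟩
    rintro ⟨φ, ⟨h1, h2⟩, h3⟩
    apply hno
    have key : ∀ v : (H.vertsᶜ : Set V), ∃ c ∈ LM.L v, φ v = .inl c := by
      rintro ⟨v, hv⟩
      have hm : φ v ∈ extS H.vertsᶜ r LM v := by
        simpa [E, extLM] using h1 v (by simp)
      rcases hc : φ v with c | u | i
      · rw [hc] at hm
        obtain ⟨_, hm⟩ := hm
        exact ⟨c, hm, rfl⟩
      · rw [hc] at hm
        obtain ⟨_, hu, ha⟩ := hm
        exfalso
        apply h2 u v (by simpa using ha)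
        rw [hc, h3 u (not_not.mp hu)]
        exact .out u v hu hv ha
      · rw [hc] at hm
        exact absurd hv hm
    choose ψ hψ1 hψ2 using key
    refine ⟨ψ, hψ1, fun u v ha hM => ?_⟩
    apply h2 u v (by simpa using ha)
    rw [hψ2, hψ2]
    exact .inner _ _ _ _ hM
  obtain ⟨G₀, hG₀⟩ := (Set.toFinite {K | P K}).exists_minimal ⟨⊤, htop⟩
  refine ⟨G₀, _, E, hG₀.prop.1, extLM_isK _ r hr LM hL, hG₀.prop.1, ?_, ?_⟩
  · intro h
    exact hG₀.prop.2 ⟨φ₀, h ▸ hφ₀, fun _ _ => rfl⟩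
  · intro G' h1 h2 h3
    refine ⟨φ₀, hφ₀, ?_, hG₀.prop.2⟩
    by_contra hcon
    exact h3 (le_antisymm h2 (hG₀.le_of_le ⟨h1, hcon⟩ h2))
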